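/- (Richter's theorem) Suppose 𝒞 is a category admitting an object 1 such that: (1) 𝒞 has all set-indexed copowers of 1; (2) 1 is a regular generator, i.e. for every object X the canonical morphism Σ_{Hom(1,X)} 1 → X is a regular epimorphism; (3) 𝒞 admits all coequalisers; (4) every internal equivalence relation in 𝒞 is effective (is the kernel pair of its coequaliser); (5a) Hom(1, 2) = {⊥, ⊤} with ⊥ ≠ ⊤, where 2 = 1 + 1; (5b) for every set I the two co-diagonal morphisms Σ_I 1 ← Σ_I 1 + Σ_I 1 ≅ Σ_I 2 → 2 are jointly monic; (5c) 2 is a coseparator for the full subcategory of 𝒞 on the set-indexed copowers of 1, i.e. for any sets I, J and distinct morphisms φ₁, φ₂ : Σ_I 1 → Σ_J 1 there is ψ : Σ_J 1 → 2 with ψ ∘ φ₁ ≠ ψ ∘ φ₂; (6) there is o ∈ Hom(1, 2) such that for every set I the copower Σ_I 1 is (1, o)-compact. Then 𝒞 is equivalent to the category KH of compact Hausdorff spaces and continuous maps. -/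

import Mathlib

open CategoryTheory CategoryTheory.Limits Opposite

universe w' w v u

namespace Paper

variable {C : Type u} [Category.{v} C]

/-- "X ≇ 0": the object `X` is not initial. -/
def NonInitial (X : C) : Prop := IsInitial X → False

/-- The category is non-trivial: `0 ≇ 1`, i.e. no object is both initial and terminal. -/
def NonTrivialCat (C : Type u) [Category.{v} C] : Prop :=
  ∀ X : C, IsInitial X → IsTerminal X → False

section Terminal
variable (C) [HasTerminal C]

/-- The category is well-pointed: the functor of points `pt = Hom(1, -)` is faithful. -/
def WellPointed : Prop :=
  ∀ ⦃X Y : C⦄ (f g : X ⟶ Y), (∀ p : ⊤_ C ⟶ X, p ≫ f = p ≫ g) → f = g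

/-- The unique morphism `X ⟶ 1` is a retraction for every `X ≇ 0`. -/
def EnoughPoints : Prop :=
  ∀ X : C, NonInitial X → Nonempty (SplitEpi (terminal.from X))

end Terminal

/-- `b` is the bottom element of `Sub(X)`. -/
def IsBotIn {X : C} (b : Subobject X) : Prop := ∀ S : Subobject X, b ≤ S

/-- `S` is an atom of the subobject lattice `Sub(X)`. -/
def IsAtomIn {X : C} (S : Subobject X) : Prop :=
  ¬ IsBotIn S ∧ ∀ T : Subobject X, T < S → IsBotIn T

/-- `Sub(X)` is atomic: every subobject is the supremum of the atoms below it. -/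
def AtomicSubobjects (X : C) : Prop :=
  ∀ S : Subobject X, IsLUB {A : Subobject X | IsAtomIn A ∧ A ≤ S} S

/-- `S` is a complemented subobject: it has a complement `T` with `S ⊓ T = ⊥`, `S ⊔ T = ⊤`. -/
def IsComplementedSub {X : C} (S : Subobject X) : Prop :=
  ∃ T m : Subobject X, IsGLB {S, T} m ∧ IsBotIn m ∧ IsLUB {S, T} ⊤

/-- A (non-empty) filter of the Boolean center `B(X)` of `Sub(X)`. -/
structure CenterFilter (X : C) where
  carrier : Set (Subobject X)
  mem_complemented : ∀ S ∈ carrier, IsComplementedSub S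
  nonempty : carrier.Nonempty
  inf_mem : ∀ S ∈ carrier, ∀ T ∈ carrier, ∀ m : Subobject X, IsGLB {S, T} m → m ∈ carrier
  mem_of_le : ∀ S ∈ carrier, ∀ T : Subobject X, IsComplementedSub T → S ≤ T → T ∈ carrier

theorem CenterFilter.ext' {X : C} {F G : CenterFilter X} (h : F.carrier = G.carrier) : F = G := by
  cases F; cases G; cases h; rfl

/-- Filters of the Boolean center, ordered by reverse inclusion. -/
instance (X : C) : PartialOrder (CenterFilter X) where
  le F G := G.carrier ⊆ F.carrier
  le_refl _ := subset_rfl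
  le_trans _ _ _ h1 h2 := fun _ hx => h1 (h2 hx)
  le_antisymm _ _ h1 h2 := CenterFilter.ext' (Set.Subset.antisymm h2 h1)

/-- An object `X` is filtral if `Sub(X)` is isomorphic, as a lattice, to the lattice of
non-empty filters of the Boolean center of `Sub(X)`. -/
def FiltralObject (X : C) : Prop :=
  Nonempty (Subobject X ≃o CenterFilter X)

/-- A category is filtral if every object is covered by a filtral one. -/
def Filtral (C : Type u) [Category.{v} C] : Prop :=
  ∀ Y : C, ∃ (X : C) (f : X ⟶ Y), Nonempty (RegularEpi f) ∧ FiltralObject X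

/-- `Sub(X)` is a complete lattice (every subset has an infimum). -/
def MonoCompleteAt (X : C) : Prop :=
  ∀ s : Set (Subobject X), ∃ m : Subobject X, IsGLB s m

/-- The category is mono-complete: every subobject poset is a complete lattice. -/
def MonoComplete (C : Type u) [Category.{v} C] : Prop := ∀ X : C, MonoCompleteAt X

section Points
variable [HasTerminal C]

/-- `Vs S` is the set of points of `X` factoring through the subobject `S`. -/
def Vs {X : C} (S : Subobject X) : Set (⊤_ C ⟶ X) := {p | S.Factors p}

open Classical in
/-- `Cg T` is the smallest subobject of `X` through which every point in `T` factors
(defined whenever the relevant infimum exists). -/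
noncomputable def Cg {X : C} (T : Set (⊤_ C ⟶ X)) : Subobject X :=
  if h : ∃ m : Subobject X, IsGLB {S : Subobject X | ∀ p ∈ T, S.Factors p} m
  then h.choose else ⊤

/-- The closure operator `cl = Vs ∘ Cg` on the power set of `pt X`. -/
noncomputable def cl {X : C} (T : Set (⊤_ C ⟶ X)) : Set (⊤_ C ⟶ X) := Vs (Cg T)

end Points

/-- Images are stable under pullback (together with finite limits and images, this is
the definition of a regular category). -/
class StableImages (C : Type u) [Category.{v} C] [HasFiniteLimits C] [HasImages C] : Prop where
  image_pullback : ∀ {X Y Z : C} (f : X ⟶ Y) (g : Z ⟶ Y),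
    (Subobject.pullback g).obj (imageSubobject f) = imageSubobject (pullback.snd f g)

/-- The extra structure of a coherent category: each `Sub(X)` has finite joins and these
are preserved by the pullback functors. -/
class CoherentJoins (C : Type u) [Category.{v} C] [HasPullbacks C] : Prop where
  exists_bot : ∀ X : C, ∃ b : Subobject X, IsBotIn b
  exists_sup : ∀ {X : C} (S T : Subobject X), ∃ U : Subobject X, IsLUB {S, T} U
  pullback_bot : ∀ {X Y : C} (f : X ⟶ Y) (b : Subobject Y),
    IsBotIn b → IsBotIn ((Subobject.pullback f).obj b)
  pullback_sup : ∀ {X Y : C} (f : X ⟶ Y) (S T U : Subobject Y), IsLUB {S, T} U →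
    IsLUB {(Subobject.pullback f).obj S, (Subobject.pullback f).obj T}
      ((Subobject.pullback f).obj U)

/-- An internal equivalence relation: a jointly-monic pair which is reflexive, symmetric and
transitive (expressed via generalised elements). -/
structure IsEquivRelPair {R X : C} (r₁ r₂ : R ⟶ X) : Prop where
  jointlyMono : ∀ {Z : C} (a b : Z ⟶ R), a ≫ r₁ = b ≫ r₁ → a ≫ r₂ = b ≫ r₂ → a = b
  refl : ∀ {Z : C} (a : Z ⟶ X), ∃ h : Z ⟶ R, h ≫ r₁ = a ∧ h ≫ r₂ = a
  symm : ∀ {Z : C} (a b : Z ⟶ X), (∃ h : Z ⟶ R, h ≫ r₁ = a ∧ h ≫ r₂ = b) →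
    ∃ h : Z ⟶ R, h ≫ r₁ = b ∧ h ≫ r₂ = a
  trans : ∀ {Z : C} (a b c : Z ⟶ X), (∃ h : Z ⟶ R, h ≫ r₁ = a ∧ h ≫ r₂ = b) →
    (∃ h : Z ⟶ R, h ≫ r₁ = b ∧ h ≫ r₂ = c) →
    ∃ h : Z ⟶ R, h ≫ r₁ = a ∧ h ≫ r₂ = c

/-- Every internal equivalence relation is effective: it is the kernel pair of its
coequaliser. -/
def EffectiveEquivRels (C : Type u) [Category.{v} C] : Prop :=
  ∀ {R X : C} (r₁ r₂ : R ⟶ X), IsEquivRelPair r₁ r₂ →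
    ∃ (Y : C) (q : X ⟶ Y) (w : r₁ ≫ q = r₂ ≫ q),
      Nonempty (IsColimit (Cofork.ofπ q w)) ∧ Nonempty (IsLimit (PullbackCone.mk r₁ r₂ w))

/-- An object is decidable if its diagonal is a complemented subobject of `X ⨯ X`. -/
def DecidableObj [HasBinaryProducts C] (X : C) : Prop :=
  ∃ (Y : C) (g : Y ⟶ X ⨯ X), Nonempty (IsColimit (BinaryCofan.mk (diag X) g))

/-- An object is pro-decidable if it is a codirected (cofiltered) limit of decidable objects. -/
def ProDecidableObj [HasBinaryProducts C] (X : C) : Prop :=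
  ∃ (J : Type v) (_ : SmallCategory J) (_ : IsCofiltered J) (D : J ⥤ C) (c : Cone D),
    (∀ j, DecidableObj (D.obj j)) ∧ Nonempty (IsLimit c) ∧ Nonempty (c.pt ≅ X)

section ReflectiveInCompHaus

/-- The preimage under a fully faithful functor of a kernel pair is an equivalence relation. -/
theorem isEquivRelPair_of_isPullback {D : Type*} [Category* D] (K : C ⥤ D) [K.Full] [K.Faithful]
    {R X : C} {Q : D} {r₁ r₂ : R ⟶ X} {f : K.obj X ⟶ Q}
    (h : IsPullback (K.map r₁) (K.map r₂) f f) : IsEquivRelPair r₁ r₂ where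
  jointlyMono a b h₁ h₂ := K.map_injective <| h.hom_ext
    (by rw [← K.map_comp, ← K.map_comp, h₁]) (by rw [← K.map_comp, ← K.map_comp, h₂])
  refl a := by
    refine ⟨K.preimage (h.lift (K.map a) (K.map a) rfl), ?_, ?_⟩ <;>
      exact K.map_injective (by simp)
  symm := by
    rintro Z a b ⟨g, rfl, rfl⟩
    refine ⟨K.preimage (h.lift (K.map (g ≫ r₂)) (K.map (g ≫ r₁)) ?_), ?_, ?_⟩
    · simp [h.w]
    · exact K.map_injective (by simp)
    · exact K.map_injective (by simp)
  trans := by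
    rintro Z a b c ⟨g, rfl, rfl⟩ ⟨k, hk, rfl⟩
    refine ⟨K.preimage (h.lift (K.map (g ≫ r₁)) (K.map (k ≫ r₂)) ?_), ?_, ?_⟩
    · have : K.map k ≫ K.map r₁ = K.map g ≫ K.map r₂ := by rw [← K.map_comp, hk, K.map_comp]
      simp only [Functor.map_comp, Category.assoc, ← h.w, reassoc_of% this]
    · exact K.map_injective (by simp)
    · exact K.map_injective (by simp)

/-- A full reflective subcategory of `CompHaus` containing the finite discrete spaces contains
all profinite spaces. -/
theorem essImage_of_totallyDisconnected (K : C ⥤ CompHaus.{v}) [Reflective K]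
    (hfin : ∀ E : CompHaus.{v}, Finite E → K.essImage E)
    (S : CompHaus.{v}) [TotallyDisconnectedSpace S] : K.essImage S := by
  let P : Profinite.{v} := Profinite.of S
  have : HasLimitsOfShape (DiscreteQuotient P) C := hasLimitsOfShape_of_reflective K
  have hP : IsLimit (profiniteToCompHaus.mapCone P.asLimitCone) :=
    isLimitOfPreserves profiniteToCompHaus P.asLimit
  refine (K.essImage).prop_of_isLimit hP fun j => hfin _ ?_
  change Finite (Quotient j.toSetoid)
  infer_instance


/-- If a reflective subcategory of `CompHaus` has effective equivalence relations and contains a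
cover of `X` and the kernel pair of this cover, then the reflection of `X` is a monomorphism. -/
theorem mono_reflectorAdjunction_unit_of_cover (K : C ⥤ CompHaus.{v}) [Reflective K]
    (heff : EffectiveEquivRels C) {X : CompHaus.{v}} {S R : C} (π : K.obj S ⟶ X)
    (hπ : Function.Surjective π) {r₁ r₂ : R ⟶ S} (h : IsPullback (K.map r₁) (K.map r₂) π π) :
    Mono ((reflectorAdjunction K).unit.app X) := by
  obtain ⟨Y, q, w, -, ⟨hq⟩⟩ := heff r₁ r₂ (isEquivRelPair_of_isPullback K h)
  have hq' : IsPullback (K.map r₁) (K.map r₂) (K.map q) (K.map q) := (IsPullback.mk ⟨w⟩ ⟨hq⟩).map K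
  have hquot : Topology.IsQuotientMap π :=
    .of_surjective_continuous hπ π.hom.hom.continuous
  have lift_points {Z : CompHaus.{v}} {f : K.obj S ⟶ Z}
      (hf : IsPullback (K.map r₁) (K.map r₂) f f) (a b : K.obj S) (hab : f a = f b) :
      ∃ c : K.obj R, K.map r₁ c = a ∧ K.map r₂ c = b := by
    let pt : K.obj S → (CompHaus.of PUnit.{v + 1} ⟶ K.obj S) := fun a =>
      CompHausLike.ofHom _ (ContinuousMap.const _ a)
    have e : pt a ≫ f = pt b ≫ f := by ext; exact hab
    exact ⟨hf.lift (pt a) (pt b) e PUnit.unit, ConcreteCategory.congr_hom (hf.lift_fst _ _ e) _,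
      ConcreteCategory.congr_hom (hf.lift_snd _ _ e) _⟩
  have hfact : Function.FactorsThrough (K.map q) π := fun a b hab => by
    obtain ⟨c, rfl, rfl⟩ := lift_points h a b hab
    exact ConcreteCategory.congr_hom hq'.w c
  let m : X ⟶ K.obj Y := CompHausLike.ofHom _ (hquot.lift (K.map q).hom.hom hfact)
  have hm : ∀ a, m (π a) = K.map q a := fun a =>
    ContinuousMap.congr_fun (hquot.lift_comp (K.map q).hom.hom hfact) a
  have : Mono m := by
    refine ConcreteCategory.mono_of_injective _ fun x y hxy => ?_
    obtain ⟨a, rfl⟩ := hπ x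
    obtain ⟨b, rfl⟩ := hπ y
    rw [hm, hm] at hxy
    obtain ⟨c, rfl, rfl⟩ := lift_points hq' a b hxy
    exact ConcreteCategory.congr_hom h.w c
  have hfac : (reflectorAdjunction K).unit.app X ≫
      K.map (((reflectorAdjunction K).homEquiv X Y).symm m) = m :=
    ((reflectorAdjunction K).homEquiv_unit ..).symm.trans (Equiv.apply_symm_apply ..)
  exact mono_of_mono_fac hfac

/-- In a full reflective subcategory of `CompHaus` with effective equivalence relations that
contains the finite discrete spaces, the components of the reflection are monomorphisms. -/
theorem mono_reflectorAdjunction_unit (K : C ⥤ CompHaus.{v}) [Reflective K]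
    (heff : EffectiveEquivRels C) (hfin : ∀ E : CompHaus.{v}, Finite E → K.essImage E)
    (X : CompHaus.{v}) : Mono ((reflectorAdjunction K).unit.app X) := by
  let B : CompHaus.{v} := CompHaus.of (Ultrafilter X)
  have : TotallyDisconnectedSpace B :=
    inferInstanceAs (TotallyDisconnectedSpace (Ultrafilter X))
  let ρ : B ⟶ X := CompHausLike.ofHom _ ⟨Ultrafilter.extend id, continuous_ultrafilter_extend id⟩
  have hρ : Function.Surjective ρ := fun x =>
    ⟨(pure x : Ultrafilter X), congrFun (ultrafilter_extend_extends id) x⟩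
  have hB : K.essImage B := essImage_of_totallyDisconnected K hfin B
  let P := CompHausLike.pullback ρ ρ
  have : TotallyDisconnectedSpace P :=
    inferInstanceAs (TotallyDisconnectedSpace {p : B × B | ρ p.1 = ρ p.2})
  have hP : K.essImage P := essImage_of_totallyDisconnected K hfin P
  have hpb : IsPullback (CompHausLike.pullback.fst ρ ρ) (CompHausLike.pullback.snd ρ ρ) ρ ρ :=
    ⟨⟨CompHausLike.pullback.condition ρ ρ⟩, ⟨CompHausLike.pullback.isLimit ρ ρ⟩⟩
  refine mono_reflectorAdjunction_unit_of_cover K heff (S := hB.witness) (R := hP.witness)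
    (hB.getIso.hom ≫ ρ) (hρ.comp ?_)
    (r₁ := K.preimage (hP.getIso.hom ≫ CompHausLike.pullback.fst ρ ρ ≫ hB.getIso.inv))
    (r₂ := K.preimage (hP.getIso.hom ≫ CompHausLike.pullback.snd ρ ρ ≫ hB.getIso.inv)) ?_
  · exact (CompHausLike.homeoOfIso hB.getIso).surjective
  · exact hpb.of_iso hP.getIso.symm hB.getIso.symm hB.getIso.symm (Iso.refl X)
      (by simp) (by simp) (by simp) (by simp)

/-- A full reflective subcategory of `CompHaus` with effective equivalence relations that
contains the finite discrete spaces is all of `CompHaus`. -/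
theorem isEquivalence_of_reflective (K : C ⥤ CompHaus.{v}) [Reflective K]
    (heff : EffectiveEquivRels C) (hfin : ∀ E : CompHaus.{v}, Finite E → K.essImage E) :
    K.IsEquivalence := by
  have hmono := mono_reflectorAdjunction_unit K heff hfin
  have hiso (X : CompHaus.{v}) : IsIso ((reflectorAdjunction K).unit.app X) := by
    have hepi : Epi ((reflectorAdjunction K).unit.app X) := by
      refine ⟨fun {Z} f g hfg => ?_⟩
      have := hmono Z
      rw [← cancel_mono ((reflectorAdjunction K).unit.app Z)]
      obtain ⟨f', hf⟩ := K.map_surjective (f ≫ (reflectorAdjunction K).unit.app Z)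
      obtain ⟨g', hg⟩ := K.map_surjective (g ≫ (reflectorAdjunction K).unit.app Z)
      rw [← hf, ← hg]
      congr 1
      apply ((reflectorAdjunction K).homEquiv _ _).injective
      simp only [Adjunction.homEquiv_unit, hf, hg, reassoc_of% hfg]
    exact CompHausLike.isIso_of_bijective _
      ⟨(CompHausLike.mono_iff_injective _).1 (hmono X), (CompHaus.epi_iff_surjective _).1 hepi⟩
  exact { essSurj := ⟨fun X =>
    ((reflectorAdjunction K).isIso_unit_app_iff_mem_essImage).1 (hiso X)⟩ }

end ReflectiveInCompHaus

/-- `one ⨿ one` has exactly two points. -/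
def HasTwoPoints (one : C) [HasBinaryCoproduct one one] : Prop :=
  (coprod.inl : one ⟶ one ⨿ one) ≠ coprod.inr ∧
    ∀ h : one ⟶ one ⨿ one, h = coprod.inl ∨ h = coprod.inr

section Copowers

variable (one : C) [∀ I : Type v, HasCoproduct fun _ : I => one]

/-- The functor sending a set `I` to the `I`-indexed copower of `one`. -/
noncomputable def copower : Type v ⥤ C where
  obj I := ∐ fun _ : I => one
  map f := Sigma.desc fun i => Sigma.ι (fun _ => one) (f i)
  map_id I := by ext; simp
  map_comp f g := by ext; simp

/-- The copower functor is left adjoint to `Hom(one, -)`. -/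
noncomputable def copowerAdj : copower one ⊣ coyoneda.obj (op one) where
  unit := { app I := ↾fun i => Sigma.ι (fun _ : I => one) i
            naturality I J f := by ext i; simp [copower] }
  counit := { app X := Sigma.desc fun p : one ⟶ X => p
              naturality X Y f := by dsimp [copower]; ext i; simp }
  left_triangle_components I := by dsimp [copower]; ext i; simp
  right_triangle_components X := by ext p; simp [copower]

variable [HasBinaryCoproduct one one]

/-- Morphisms into `∐_{I ⊕ I} one` are determined by their composites with both co-diagonals. -/
def CodiagonalsJointlyMonic : Prop :=
  ∀ (I : Type v) {Z : C} (a b : Z ⟶ ∐ fun _ : I ⊕ I => one),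
    a ≫ Sigma.desc (fun i => Sigma.ι (fun _ : I => one) (Sum.elim id id i)) =
      b ≫ Sigma.desc (fun i => Sigma.ι (fun _ : I => one) (Sum.elim id id i)) →
    a ≫ Sigma.desc (fun i => Sum.elim (fun _ => (coprod.inl : one ⟶ one ⨿ one))
          (fun _ => (coprod.inr : one ⟶ one ⨿ one)) i) =
      b ≫ Sigma.desc (fun i => Sum.elim (fun _ => (coprod.inl : one ⟶ one ⨿ one))
          (fun _ => (coprod.inr : one ⟶ one ⨿ one)) i) →
    a = b

/-- `one ⨿ one` separates morphisms between copowers of `one`. -/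
def TwoSeparatesCopowers : Prop :=
  ∀ (I J : Type v) (φ₁ φ₂ : (∐ fun _ : I => one) ⟶ ∐ fun _ : J => one),
    φ₁ ≠ φ₂ → ∃ ψ : (∐ fun _ : J => one) ⟶ one ⨿ one, φ₁ ≫ ψ ≠ φ₂ ≫ ψ

/-- Every cover of a copower of `one` by morphisms to `one ⨿ one` has a finite subcover. -/
def CopowersCompact : Prop :=
  ∃ o : one ⟶ one ⨿ one, ∀ I : Type v,
    ∀ U : Set ((∐ fun _ : I => one) ⟶ one ⨿ one),
      (∀ p : one ⟶ ∐ fun _ : I => one, ∃ d ∈ U, p ≫ d = o) →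
      ∃ V ⊆ U, V.Finite ∧ ∀ p : one ⟶ ∐ fun _ : I => one, ∃ d ∈ V, p ≫ d = o

variable {one}

open Classical in
/-- The morphism from a copower of `one` to `one ⨿ one` classifying the set `A`. -/
noncomputable def copowerChar {I : Type v} (A : Set I) : (∐ fun _ : I => one) ⟶ one ⨿ one :=
  Sigma.desc fun i => if i ∈ A then coprod.inl else coprod.inr

open Classical in
@[simp]
theorem ι_copowerChar {I : Type v} (A : Set I) (i : I) :
    Sigma.ι (fun _ : I => one) i ≫ copowerChar A = if i ∈ A then coprod.inl else coprod.inr := by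
  simp [copowerChar]

theorem desc_ι_copowerChar {I J : Type v} (f : I → J) (A : Set J) :
    Sigma.desc (fun i => Sigma.ι (fun _ : J => one) (f i)) ≫ copowerChar A =
      copowerChar (f ⁻¹' A) := by
  ext i
  simp only [colimit.ι_desc_assoc, Cofan.mk_ι_app]
  exact (ι_copowerChar (one := one) A (f i)).trans
    (ι_copowerChar (one := one) (f ⁻¹' A) i).symm

theorem HasTwoPoints.exists_eq_copowerChar (h : HasTwoPoints one) {J : Type v}
    (ψ : (∐ fun _ : J => one) ⟶ one ⨿ one) : ∃ A : Set J, ψ = copowerChar A := by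
  refine ⟨{j | Sigma.ι (fun _ => one) j ≫ ψ = coprod.inl}, ?_⟩
  ext j
  rw [ι_copowerChar]
  split_ifs with hj
  · exact hj
  · exact (h.2 _).resolve_left hj

theorem HasTwoPoints.exists_eq_ι_bool (h : HasTwoPoints one)
    (p : one ⟶ ∐ fun _ : ULift.{v} Bool => one) :
    ∃ b, p = Sigma.ι (fun _ : ULift.{v} Bool => one) b := by
  let e : (∐ fun _ : ULift.{v} Bool => one) ⟶ one ⨿ one :=
    Sigma.desc fun b => cond b.down coprod.inl coprod.inr
  let e' : one ⨿ one ⟶ ∐ fun _ : ULift.{v} Bool => one :=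
    coprod.desc (Sigma.ι (fun _ => one) ⟨true⟩) (Sigma.ι (fun _ => one) ⟨false⟩)
  have he : e ≫ e' = 𝟙 _ := by
    ext ⟨b⟩
    cases b <;> simp [e, e', coprod.inl_desc, coprod.inr_desc]
  rcases h.2 (p ≫ e) with hp | hp
  · exact ⟨⟨true⟩, by simpa [he, e', coprod.inl_desc, coprod.inr_desc] using congrArg (· ≫ e') hp⟩
  · exact ⟨⟨false⟩, by simpa [he, e', coprod.inl_desc, coprod.inr_desc] using congrArg (· ≫ e') hp⟩

theorem HasTwoPoints.exists_eq_ι_bool_sum (h : HasTwoPoints one)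
    (hmono : CodiagonalsJointlyMonic one)
    (p : one ⟶ ∐ fun _ : ULift.{v} Bool ⊕ ULift.{v} Bool => one) :
    ∃ k, p = Sigma.ι (fun _ : ULift.{v} Bool ⊕ ULift.{v} Bool => one) k := by
  obtain ⟨b, hb⟩ := h.exists_eq_ι_bool
    (p ≫ Sigma.desc (fun i => Sigma.ι (fun _ => one) (Sum.elim id id i)))
  rcases h.2 (p ≫ Sigma.desc (fun i => Sum.elim (fun _ => (coprod.inl : one ⟶ one ⨿ one))
          (fun _ => (coprod.inr : one ⟶ one ⨿ one)) i)) with hp | hp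
  · exact ⟨.inl b, hmono _ _ _ (by simp [hb]) (by simp [hp])⟩
  · exact ⟨.inr b, hmono _ _ _ (by simp [hb]) (by simp [hp])⟩

open Classical in
/-- A point of a copower behaves like an element with respect to two given subsets. -/
theorem HasTwoPoints.exists_classifier (h : HasTwoPoints one)
    (hmono : CodiagonalsJointlyMonic one) {I : Type v} (p : one ⟶ ∐ fun _ : I => one)
    (A B : Set I) : ∃ (J : Type v) (c : I → J) (k : J) (A' B' : Set J),
      A = c ⁻¹' A' ∧ B = c ⁻¹' B' ∧ ∀ S, p ≫ copowerChar (c ⁻¹' S) = coprod.inl ↔ k ∈ S := by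
  let c : I → ULift.{v} Bool ⊕ ULift.{v} Bool := fun i =>
    if i ∈ B then .inl ⟨decide (i ∈ A)⟩ else .inr ⟨decide (i ∈ A)⟩
  obtain ⟨k, hk⟩ := h.exists_eq_ι_bool_sum hmono
    (p ≫ Sigma.desc fun i => Sigma.ι (fun _ => one) (c i))
  refine ⟨_, c, k, {k | (Sum.elim id id k).down = true}, {k | k.isLeft}, ?_, ?_, fun S => ?_⟩
  · ext i
    by_cases hi : i ∈ B <;> simp [c, hi]
  · ext i
    by_cases hi : i ∈ B <;> simp [c, hi]
  · rw [← desc_ι_copowerChar, reassoc_of% hk, ι_copowerChar]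
    split_ifs with hS
    · simpa
    · simpa [hS] using h.1.symm

theorem HasTwoPoints.comp_copowerChar_compl (h : HasTwoPoints one)
    (hmono : CodiagonalsJointlyMonic one) {I : Type v} (p : one ⟶ ∐ fun _ : I => one)
    (A : Set I) : p ≫ copowerChar Aᶜ = coprod.inl ↔ ¬ p ≫ copowerChar A = coprod.inl := by
  obtain ⟨J, c, k, A', -, rfl, -, hk⟩ := h.exists_classifier hmono p A A
  rw [← Set.preimage_compl, hk, hk, Set.mem_compl_iff]

theorem HasTwoPoints.comp_copowerChar_inter (h : HasTwoPoints one)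
    (hmono : CodiagonalsJointlyMonic one) {I : Type v} (p : one ⟶ ∐ fun _ : I => one)
    (A B : Set I) : p ≫ copowerChar (A ∩ B) = coprod.inl ↔
      p ≫ copowerChar A = coprod.inl ∧ p ≫ copowerChar B = coprod.inl := by
  obtain ⟨J, c, k, A', B', rfl, rfl, hk⟩ := h.exists_classifier hmono p A B
  rw [← Set.preimage_inter, hk, hk, hk, Set.mem_inter_iff]

/-- The ultrafilter on `I` of a point of the `I`-indexed copower of `one`. -/
noncomputable def HasTwoPoints.ultrafilter (h : HasTwoPoints one)
    (hmono : CodiagonalsJointlyMonic one) {I : Type v} (p : one ⟶ ∐ fun _ : I => one) :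
    Ultrafilter I :=
  Ultrafilter.ofComplNotMemIff
    { sets := {A | p ≫ copowerChar A = coprod.inl}
      univ_sets := by
        have e : (Set.univ : Set I) = (∅ ∩ ∅ᶜ)ᶜ := by simp
        rw [Set.mem_ofPred_eq, e, h.comp_copowerChar_compl hmono, h.comp_copowerChar_inter hmono,
          h.comp_copowerChar_compl hmono]
        exact fun H => H.2 H.1
      sets_of_superset := fun {A B} hA hAB => by
        rw [Set.mem_ofPred_eq, ← Set.inter_eq_left.2 hAB, h.comp_copowerChar_inter hmono] at hA
        exact hA.2
      inter_sets := fun hA hB => (h.comp_copowerChar_inter hmono p _ _).2 ⟨hA, hB⟩ }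
    fun A => by
      change ¬ (p ≫ copowerChar Aᶜ = coprod.inl) ↔ p ≫ copowerChar A = coprod.inl
      rw [h.comp_copowerChar_compl hmono, not_not]

theorem HasTwoPoints.mem_ultrafilter (h : HasTwoPoints one)
    (hmono : CodiagonalsJointlyMonic one) {I : Type v} (p : one ⟶ ∐ fun _ : I => one)
    (A : Set I) : A ∈ h.ultrafilter hmono p ↔ p ≫ copowerChar A = coprod.inl :=
  Iff.rfl

theorem HasTwoPoints.ultrafilter_injective (h : HasTwoPoints one)
    (hmono : CodiagonalsJointlyMonic one) (hsep : TwoSeparatesCopowers one) (I : Type v) :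
    Function.Injective (h.ultrafilter hmono (I := I)) := by
  intro p q hpq
  by_contra hne
  obtain ⟨ψ, hψ⟩ := hsep PUnit I (Sigma.desc fun _ => p) (Sigma.desc fun _ => q) fun e =>
    hne (by simpa using congrArg (Sigma.ι (fun _ : PUnit => one) PUnit.unit ≫ ·) e)
  obtain ⟨A, rfl⟩ := h.exists_eq_copowerChar ψ
  refine hψ ?_
  ext
  simp only [colimit.ι_desc_assoc, Cofan.mk_ι_app]
  have hA : p ≫ copowerChar A = coprod.inl ↔ q ≫ copowerChar A = coprod.inl := by
    rw [← h.mem_ultrafilter hmono, hpq, h.mem_ultrafilter]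
  by_cases hp : p ≫ copowerChar A = coprod.inl
  · rw [hp, hA.1 hp]
  · rw [(h.2 _).resolve_left hp, (h.2 _).resolve_left (mt hA.2 hp)]

theorem HasTwoPoints.ultrafilter_surjective (h : HasTwoPoints one)
    (hmono : CodiagonalsJointlyMonic one) (hcpt : CopowersCompact one) (I : Type v) :
    Function.Surjective (h.ultrafilter hmono (I := I)) := by
  intro F
  by_contra! hF
  have hex (p : one ⟶ ∐ fun _ : I => one) :
      ∃ A ∈ F, ¬ p ≫ copowerChar A = coprod.inl := by
    by_contra! hA
    exact hF p (Ultrafilter.coe_le_coe.1 fun A hAF => hA A hAF)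
  obtain ⟨o, ho⟩ := hcpt
  obtain ⟨d, hd⟩ : ∃ d : Set I → ((∐ fun _ : I => one) ⟶ one ⨿ one), ∀ A p,
      p ≫ d A = o ↔ ¬ p ≫ copowerChar A = coprod.inl := by
    rcases h.2 o with rfl | rfl
    · exact ⟨fun A => copowerChar Aᶜ, fun A p => h.comp_copowerChar_compl hmono p A⟩
    · refine ⟨copowerChar, fun A p => ⟨fun e => ?_, (h.2 _).resolve_left⟩⟩
      rw [e]
      exact h.1.symm
  obtain ⟨V, hVU, hV, hcov⟩ := ho I (d '' {A | A ∈ F}) fun p => by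
    obtain ⟨A, hA, hp⟩ := hex p
    exact ⟨d A, ⟨A, hA, rfl⟩, (hd A p).2 hp⟩
  obtain ⟨T, hTF, hT, rfl⟩ := Set.exists_subset_image_finite_and.1 ⟨V, hVU, hV, rfl⟩
  have hmem : ⋂₀ T ∈ (F : Filter I) := (Filter.sInter_mem hT).2 fun A hA => hTF hA
  obtain ⟨i, hi⟩ := F.nonempty_of_mem hmem
  obtain ⟨_, ⟨A, hA, rfl⟩, hA'⟩ := hcov (Sigma.ι (fun _ => one) i)
  rw [hd, ι_copowerChar, if_pos (hi A hA)] at hA'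
  exact hA' rfl

theorem HasTwoPoints.ultrafilter_desc_ι (h : HasTwoPoints one)
    (hmono : CodiagonalsJointlyMonic one) {I J : Type v} (f : I → J)
    (p : one ⟶ ∐ fun _ : I => one) :
    h.ultrafilter hmono (p ≫ Sigma.desc fun i => Sigma.ι (fun _ : J => one) (f i)) =
      Ultrafilter.map f (h.ultrafilter hmono p) := by
  refine Ultrafilter.coe_injective (Filter.ext fun A => ?_)
  rw [Ultrafilter.mem_coe, Ultrafilter.mem_coe, Ultrafilter.mem_map, h.mem_ultrafilter,
    h.mem_ultrafilter, Category.assoc, desc_ι_copowerChar]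

theorem HasTwoPoints.ultrafilter_ι (h : HasTwoPoints one)
    (hmono : CodiagonalsJointlyMonic one) {I : Type v} (i : I) :
    h.ultrafilter hmono (Sigma.ι (fun _ : I => one) i) = pure i := by
  refine Ultrafilter.coe_injective (Filter.ext fun A => ?_)
  rw [Ultrafilter.mem_coe, Ultrafilter.mem_coe, Ultrafilter.mem_pure, h.mem_ultrafilter,
    ι_copowerChar]
  split_ifs with hi
  · simpa
  · simpa [hi] using h.1.symm

theorem HasTwoPoints.bijective_ι_of_finite (h : HasTwoPoints one)
    (hmono : CodiagonalsJointlyMonic one) (hsep : TwoSeparatesCopowers one)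
    (E : Type v) [Finite E] : Function.Bijective (Sigma.ι fun _ : E => one) := by
  refine ⟨fun i j hij => Ultrafilter.pure_injective ?_, fun p => ?_⟩
  · rw [← h.ultrafilter_ι hmono, hij, h.ultrafilter_ι hmono]
  · obtain ⟨i, hi⟩ := (h.ultrafilter hmono p).eq_pure_of_finite
    exact ⟨i, h.ultrafilter_injective hmono hsep E ((h.ultrafilter_ι hmono i).trans hi.symm)⟩

theorem HasTwoPoints.ultrafilter_desc_id (h : HasTwoPoints one)
    (hmono : CodiagonalsJointlyMonic one) {I : Type v}
    (p : one ⟶ ∐ fun _ : (one ⟶ ∐ fun _ : I => one) => one) :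
    h.ultrafilter hmono (p ≫ Sigma.desc fun q : one ⟶ ∐ fun _ : I => one => q) =
      joinM (Ultrafilter.map (h.ultrafilter hmono) (h.ultrafilter hmono p)) := by
  refine Ultrafilter.coe_injective (Filter.ext fun A => ?_)
  have e : (Sigma.desc fun q : one ⟶ ∐ fun _ : I => one => q) ≫ copowerChar A =
      copowerChar {q | A ∈ h.ultrafilter hmono q} := by
    ext q
    simp only [colimit.ι_desc_assoc, Cofan.mk_ι_app]
    rw [ι_copowerChar]
    split_ifs with hq
    · exact hq
    · exact (h.2 _).resolve_left hq
  rw [Ultrafilter.mem_coe, h.mem_ultrafilter, Category.assoc, e]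
  rfl

/-- The monad of points of copowers of `one` is the ultrafilter monad. -/
noncomputable def HasTwoPoints.monadIso (h : HasTwoPoints one)
    (hmono : CodiagonalsJointlyMonic one) (hsep : TwoSeparatesCopowers one)
    (hcpt : CopowersCompact one) : (copowerAdj one).toMonad ≅ ofTypeMonad Ultrafilter :=
  MonadIso.mk
    (NatIso.ofComponents
      (fun I => (Equiv.ofBijective (h.ultrafilter hmono (I := I))
        ⟨h.ultrafilter_injective hmono hsep I, h.ultrafilter_surjective hmono hcpt I⟩).toIso)
      fun {I J} f => by
        ext p
        exact h.ultrafilter_desc_ι hmono f p)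
    (fun I => by
      ext i
      exact h.ultrafilter_ι hmono i)
    (fun I => by
      ext p
      exact (h.ultrafilter_desc_id hmono p).trans
        (congrArg joinM (h.ultrafilter_desc_ι hmono (h.ultrafilter hmono) p).symm))

end Copowers

section Comparison

/-- An equivalence of categories is a reflective functor. -/
noncomputable abbrev reflectiveOfIsEquivalence {D E : Type*} [Category* D] [Category* E]
    (G : D ⥤ E) [G.IsEquivalence] : Reflective G where
  L := G.inv
  adj := G.asEquivalence.symm.toAdjunction

variable (one : C) [∀ I : Type v, HasCoproduct fun _ : I => one]

/-- If `one` is a regular generator, every object is the coequaliser of its canonical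
presentation by copowers of `one`. -/
theorem nonempty_isColimit_counitCofork
    (hgen : ∀ X : C, Nonempty (RegularEpi (Sigma.desc fun p : one ⟶ X => p))) (X : C) :
    Nonempty (IsColimit (Monad.MonadicityInternal.counitCofork (copowerAdj one) X)) := by
  obtain ⟨r⟩ := hgen X
  have epi (W : C) : Epi (Sigma.desc fun p : one ⟶ W => p) := (hgen W).some.epi
  have key {Z : C} (k : (∐ fun _ : one ⟶ X => one) ⟶ Z)
      (hk : (copower one).map ((coyoneda.obj (op one)).map ((copowerAdj one).counit.app X)) ≫ k =
        (copowerAdj one).counit.app _ ≫ k) : r.left ≫ k = r.right ≫ k := by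
    have hpt (x : one ⟶ ∐ fun _ : one ⟶ X => one) :
        x ≫ k = Sigma.ι (fun _ : one ⟶ X => one) (x ≫ Sigma.desc fun p : one ⟶ X => p) ≫ k := by
      have := congrArg (Sigma.ι (fun _ : one ⟶ ∐ fun _ : one ⟶ X => one => one) x ≫ ·) hk
      simp only [copower, copowerAdj, ← Category.assoc] at this
      simpa using this.symm
    rw [← cancel_epi (Sigma.desc fun p : one ⟶ r.W => p)]
    ext w
    simp only [colimit.ι_desc_assoc, Cofan.mk_ι_app]
    have h₁ := hpt (w ≫ r.left)
    have h₂ := hpt (w ≫ r.right)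
    rw [Category.assoc, Category.assoc] at h₁ h₂
    rw [h₁, h₂, r.w]
  exact ⟨Cofork.IsColimit.mk' _ fun s =>
    ⟨Cofork.IsColimit.desc r.isColimit s.π (key s.π s.condition),
      Cofork.IsColimit.π_desc' r.isColimit s.π _,
      fun {m} hm => Cofork.IsColimit.hom_ext r.isColimit
        (hm.trans (Cofork.IsColimit.π_desc' r.isColimit s.π _).symm)⟩⟩

/-- If `one` is a regular generator, the category is reflective in the category of algebras of
the induced monad. -/
noncomputable abbrev reflectiveComparison [HasCoequalizers C]
    (hgen : ∀ X : C, Nonempty (RegularEpi (Sigma.desc fun p : one ⟶ X => p))) :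
    Reflective (Monad.comparison (copowerAdj one)) :=
  have (X : C) :
      IsIso ((Monad.MonadicityInternal.comparisonAdjunction (copowerAdj one)).counit.app X) := by
    rw [Monad.MonadicityInternal.comparisonAdjunction_counit_app]
    exact ((colimit.isColimit _).coconePointUniqueUpToIso
      (nonempty_isColimit_counitCofork one hgen X).some).isIso_hom
  have : IsIso (Monad.MonadicityInternal.comparisonAdjunction (copowerAdj one)).counit :=
    NatIso.isIso_of_isIso_app _
  let ff :=
    (Monad.MonadicityInternal.comparisonAdjunction (copowerAdj one)).fullyFaithfulROfIsIsoCounit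
  { toFull := ff.full
    toFaithful := ff.faithful
    L := Monad.MonadicityInternal.leftAdjointComparison (copowerAdj one)
    adj := Monad.MonadicityInternal.comparisonAdjunction (copowerAdj one) }

variable [HasBinaryCoproduct one one] {one}

/-- The equivalence between algebras for the monad of points of copowers of `one` and compacta. -/
noncomputable def HasTwoPoints.algebraEquivCompactum (h : HasTwoPoints one)
    (hmono : CodiagonalsJointlyMonic one) (hsep : TwoSeparatesCopowers one)
    (hcpt : CopowersCompact one) : (copowerAdj one).toMonad.Algebra ≌ Compactum.{v} :=
  Monad.algebraEquivOfIsoMonads (h.monadIso hmono hsep hcpt)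

/-- The functor sending an object to its compact Hausdorff space of points. -/
noncomputable def HasTwoPoints.toCompHaus (h : HasTwoPoints one)
    (hmono : CodiagonalsJointlyMonic one) (hsep : TwoSeparatesCopowers one)
    (hcpt : CopowersCompact one) : C ⥤ CompHaus.{v} :=
  Monad.comparison (copowerAdj one) ⋙
    (h.algebraEquivCompactum hmono hsep hcpt).functor ⋙ compactumToCompHaus

/-- The functor of points is reflective if `one` is a regular generator. -/
noncomputable abbrev HasTwoPoints.reflectiveToCompHaus (h : HasTwoPoints one)
    (hmono : CodiagonalsJointlyMonic one) (hsep : TwoSeparatesCopowers one)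
    (hcpt : CopowersCompact one) [HasCoequalizers C]
    (hgen : ∀ X : C, Nonempty (RegularEpi (Sigma.desc fun p : one ⟶ X => p))) :
    Reflective (h.toCompHaus hmono hsep hcpt) :=
  have := reflectiveComparison one hgen
  have := reflectiveOfIsEquivalence
    ((h.algebraEquivCompactum hmono hsep hcpt).functor ⋙ compactumToCompHaus)
  Reflective.comp (Monad.comparison (copowerAdj one))
    ((h.algebraEquivCompactum hmono hsep hcpt).functor ⋙ compactumToCompHaus)

/-- Finite discrete spaces are spaces of points of finite copowers of `one`. -/
theorem HasTwoPoints.essImage_toCompHaus_of_finite (h : HasTwoPoints one)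
    (hmono : CodiagonalsJointlyMonic one) (hsep : TwoSeparatesCopowers one)
    (hcpt : CopowersCompact one) (E : CompHaus.{v}) [Finite E] :
    (h.toCompHaus hmono hsep hcpt).essImage E := by
  have : DiscreteTopology E :=
    have : T1Space E := T2Space.t1Space
    Finite.instDiscreteTopology
  let f : E ⟶ (h.toCompHaus hmono hsep hcpt).obj (∐ fun _ : E => one) :=
    CompHausLike.ofHom (Y := ((h.toCompHaus hmono hsep hcpt).obj (∐ fun _ : E => one)).toTop) _
      ⟨Sigma.ι fun _ : E => one, continuous_of_discreteTopology⟩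
  have := CompHausLike.isIso_of_bijective f (h.bijective_ι_of_finite hmono hsep E)
  exact ⟨_, ⟨(asIso f).symm⟩⟩

end Comparison

/-- **Richter's theorem**: a category satisfying Richter's axioms (1)–(6) for an object
`1` is equivalent to `KH`. -/
theorem richter (one : C)
    [hcop : ∀ I : Type v, HasCoproduct fun _ : I => one]
    [HasBinaryCoproduct one one]
    (hgen : ∀ X : C, Nonempty (RegularEpi (Sigma.desc fun p : one ⟶ X => p)))
    [HasCoequalizers C]
    (heff : EffectiveEquivRels C)
    (h5a : (coprod.inl : one ⟶ one ⨿ one) ≠ coprod.inr ∧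
      ∀ h : one ⟶ one ⨿ one, h = coprod.inl ∨ h = coprod.inr)
    (h5b : ∀ (I : Type v) {Z : C} (a b : Z ⟶ ∐ fun _ : I ⊕ I => one),
      a ≫ Sigma.desc (fun i => Sigma.ι (fun _ : I => one) (Sum.elim id id i)) =
        b ≫ Sigma.desc (fun i => Sigma.ι (fun _ : I => one) (Sum.elim id id i)) →
      a ≫ Sigma.desc (fun i => Sum.elim (fun _ => (coprod.inl : one ⟶ one ⨿ one))
            (fun _ => (coprod.inr : one ⟶ one ⨿ one)) i) =
        b ≫ Sigma.desc (fun i => Sum.elim (fun _ => (coprod.inl : one ⟶ one ⨿ one))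
            (fun _ => (coprod.inr : one ⟶ one ⨿ one)) i) →
      a = b)
    (h5c : ∀ (I J : Type v) (φ₁ φ₂ : (∐ fun _ : I => one) ⟶ ∐ fun _ : J => one),
      φ₁ ≠ φ₂ → ∃ ψ : (∐ fun _ : J => one) ⟶ one ⨿ one, φ₁ ≫ ψ ≠ φ₂ ≫ ψ)
    (h6 : ∃ o : one ⟶ one ⨿ one, ∀ I : Type v,
      ∀ U : Set ((∐ fun _ : I => one) ⟶ one ⨿ one),
        (∀ p : one ⟶ ∐ fun _ : I => one, ∃ d ∈ U, p ≫ d = o) →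
        ∃ V ⊆ U, V.Finite ∧ ∀ p : one ⟶ ∐ fun _ : I => one, ∃ d ∈ V, p ≫ d = o) :
    Nonempty (C ≌ CompHaus.{v}) := by
  have h : HasTwoPoints one := h5a
  have := h.reflectiveToCompHaus h5b h5c h6 hgen
  have := isEquivalence_of_reflective (h.toCompHaus h5b h5c h6) heff fun E _ =>
    h.essImage_toCompHaus_of_finite h5b h5c h6 E
  exact ⟨(h.toCompHaus h5b h5c h6).asEquivalence⟩

end Paper
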